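/- Let λ > 0 and let I_λ = [1, x_att] where x_att = 1 + λ/2 + √(λ + λ²/4). Then I_λ is a trapping interval for both F_0 and F_λ: F_0(I_λ) ⊆ I_λ and F_λ(I_λ) ⊆ I_λ. Moreover, for every x ∈ I_λ one has |F_0'(x)| ≤ 1 and |F_λ'(x)| ≤ 1. -/

import Mathlib

theorem abs_deriv_const_sub_one_div_le_one (c : ℝ) {x : ℝ} (hx : 1 ≤ x) :
    |deriv (fun y : ℝ => c - 1 / y) x| ≤ 1 := by
  have hderiv : deriv (fun y : ℝ => c - 1 / y) x = (x ^ 2)⁻¹ := by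
    simp [deriv_const_sub]
  rw [hderiv, abs_of_nonneg (by positivity)]
  exact inv_le_one_of_one_le₀ (one_le_pow₀ hx)

/-- `I_λ = [1, x_att]` is a trapping interval for `F_0` and `F_λ`,
and on it both maps have derivative of absolute value at most `1`. -/
theorem stmt2 (lam : ℝ) (hlam : 0 < lam)
    (xatt : ℝ) (hatt : xatt = 1 + lam / 2 + Real.sqrt (lam + lam ^ 2 / 4))
    (F0 Flam : ℝ → ℝ)
    (hF0 : ∀ x, F0 x = 2 - 1 / x) (hFlam : ∀ x, Flam x = 2 + lam - 1 / x) :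
    (∀ x ∈ Set.Icc (1 : ℝ) xatt, F0 x ∈ Set.Icc (1 : ℝ) xatt) ∧
    (∀ x ∈ Set.Icc (1 : ℝ) xatt, Flam x ∈ Set.Icc (1 : ℝ) xatt) ∧
    (∀ x ∈ Set.Icc (1 : ℝ) xatt, |deriv F0 x| ≤ 1 ∧ |deriv Flam x| ≤ 1) := by
  have hpos : 0 < xatt := by rw [hatt]; positivity
  have hquad : xatt ^ 2 = (2 + lam) * xatt - 1 := by
    have hsq := Real.sq_sqrt (show 0 ≤ lam + lam ^ 2 / 4 by positivity)
    rw [hatt]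
    linear_combination hsq
  have hfix : 2 + lam - 1 / xatt = xatt := by
    field_simp
    linarith
  have hbounds : ∀ x ∈ Set.Icc (1 : ℝ) xatt, 1 / x ≤ 1 ∧ 1 / xatt ≤ 1 / x := by
    intro x hx
    have hx0 : 0 < x := one_pos.trans_le hx.1
    exact ⟨(div_le_one hx0).2 hx.1, one_div_le_one_div_of_le hx0 hx.2⟩
  refine ⟨fun x hx => ?_, fun x hx => ?_, fun x hx => ?_⟩
  · obtain ⟨h₁, h₂⟩ := hbounds x hx
    rw [hF0]
    constructor <;> linarith
  · obtain ⟨h₁, h₂⟩ := hbounds x hx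
    rw [hFlam]
    constructor <;> linarith
  · rw [funext hF0, funext hFlam]
    exact ⟨abs_deriv_const_sub_one_div_le_one _ hx.1, abs_deriv_const_sub_one_div_le_one _ hx.1⟩
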